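/- arXiv:1703.10950 — 3 statements merged into one kernel-verified Lean document; each statement's English description precedes it below -/
import Mathlib

section
/- A pure bipartite state with full Schmidt rank and pairwise distinct Schmidt coefficients is determined by its two one-sided marginals up to phases on the Schmidt terms. Precisely: let N ≥ 1, let (e_i) and (f_i), i ∈ Fin N, be orthonormal bases of ℂ^N, and let λ : Fin N → ℝ be pairwise distinct with λ_i > 0 for all i and Σ λ_i = 1. Define the unit vector ψ : Fin N × Fin N → ℂ by ψ(x,y) = Σ_i √λ_i · e_i(x) · f_i(y). If φ : Fin N × Fin N → ℂ is a unit vector with ρ₁(φ) = ρ₁(ψ) and ρ₂(φ) = ρ₂(ψ), then there exist real numbers θ_i such that φ(x,y) = Σ_i exp(I·θ_i) · √λ_i · e_i(x) · f_i(y) for all x,y. -/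
/-!
STATEMENT 5: A pure bipartite state with full Schmidt rank and pairwise distinct
Schmidt coefficients is determined by its two one-sided marginals up to phases
on the Schmidt terms.
-/

noncomputable section

/-- The first (one-sided) marginal of a bipartite vector. -/
def rho1 (N : ℕ) (ψ : Fin N × Fin N → ℂ) : Matrix (Fin N) (Fin N) ℂ := fun x x' =>
  ∑ y : Fin N, ψ (x, y) * starRingEnd ℂ (ψ (x', y))

/-- The second (one-sided) marginal of a bipartite vector. -/
def rho2 (N : ℕ) (ψ : Fin N × Fin N → ℂ) : Matrix (Fin N) (Fin N) ℂ := fun y y' =>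
  ∑ x : Fin N, ψ (x, y) * starRingEnd ℂ (ψ (x, y'))

open Matrix in
/-- A matrix whose two Gram matrices are the same diagonal matrix with distinct entries is
diagonal. -/
theorem Matrix.apply_eq_zero_of_gram_eq_diagonal {n : Type*} [Fintype n] [DecidableEq n]
    {C : Matrix n n ℂ} {d : n → ℂ} (hd : Function.Injective d)
    (h1 : C * Cᴴ = diagonal d) (h2 : Cᴴ * C = diagonal d) {i j : n} (hij : i ≠ j) :
    C i j = 0 := by
  have h : C * diagonal d = diagonal d * C := by rw [← h2, ← Matrix.mul_assoc, h1, h2]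
  have hc := congrFun (congrFun h i) j
  rw [mul_diagonal, diagonal_mul, mul_comm] at hc
  have : (d j - d i) * C i j = 0 := by rw [sub_mul, hc, sub_self]
  exact (mul_eq_zero.mp this).resolve_left (sub_ne_zero.mpr fun h => hij (hd h).symm)

/-- The polar form of a complex number of given squared modulus. -/
theorem Complex.eq_exp_arg_mul_sqrt {z : ℂ} {r : ℝ}
    (h : z * starRingEnd ℂ z = r) :
    z = Complex.exp (Complex.I * (z.arg : ℂ)) * (Real.sqrt r : ℂ) := by
  have hr : ‖z‖ = Real.sqrt r := by
    rw [Complex.mul_conj, Complex.ofReal_inj, Complex.normSq_eq_norm_sq] at h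
    rw [← h, Real.sqrt_sq (norm_nonneg z)]
  rw [← hr, mul_comm, mul_comm Complex.I]
  exact (Complex.norm_mul_exp_arg_mul_I z).symm

open Matrix in
/-- Entries of the matrix with diagonal coefficients `d` in the product of two bases. -/
theorem Matrix.transpose_mul_diagonal_mul_apply {n : Type*} [Fintype n] [DecidableEq n]
    (U V : Matrix n n ℂ) (d : n → ℂ) (x y : n) :
    (Uᵀ * diagonal d * V) x y = ∑ i, d i * U i x * V i y := by
  rw [mul_apply]
  exact Finset.sum_congr rfl fun i _ => by rw [mul_diagonal, transpose_apply, mul_comm (d i)]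

open Matrix in
/-- Unitary factors on both sides cancel from an equality of Gram matrices. -/
theorem Matrix.gram_eq_of_unitary_conj {n : Type*} [Fintype n] [DecidableEq n]
    {P Q A B : Matrix n n ℂ} (hP : Pᴴ * P = 1) (hQ : Q * Qᴴ = 1)
    (h : (P * A * Q) * (P * A * Q)ᴴ = (P * B * Q) * (P * B * Q)ᴴ) :
    A * Aᴴ = B * Bᴴ := by
  have key : ∀ X : Matrix n n ℂ, Pᴴ * ((P * X * Q) * (P * X * Q)ᴴ) * P = X * Xᴴ := fun X =>
    calc Pᴴ * ((P * X * Q) * (P * X * Q)ᴴ) * P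
        = (Pᴴ * P) * X * (Q * Qᴴ) * Xᴴ * (Pᴴ * P) := by
          simp only [conjTranspose_mul, Matrix.mul_assoc]
      _ = X * Xᴴ := by simp [hP, hQ]
  rw [← key A, ← key B, h]

theorem bipartite_state_determined_up_to_phases_by_marginals
    (N : ℕ) (hN : 1 ≤ N)
    (e f : Fin N → Fin N → ℂ)
    (he_orth : ∀ i j, ∑ x, e i x * starRingEnd ℂ (e j x) = if i = j then 1 else 0)
    (he_span : Submodule.span ℂ (Set.range e) = ⊤)
    (hf_orth : ∀ i j, ∑ x, f i x * starRingEnd ℂ (f j x) = if i = j then 1 else 0)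
    (hf_span : Submodule.span ℂ (Set.range f) = ⊤)
    (lam : Fin N → ℝ)
    (hdist : ∀ i j, i ≠ j → lam i ≠ lam j)
    (hpos : ∀ i, 0 < lam i)
    (hsum : ∑ i, lam i = 1)
    (ψ : Fin N × Fin N → ℂ)
    (hψ : ∀ x y, ψ (x, y) = ∑ i, (Real.sqrt (lam i) : ℂ) * e i x * f i y)
    (φ : Fin N × Fin N → ℂ)
    (hφ_unit : ∑ p, ‖φ p‖ ^ 2 = (1 : ℝ))
    (h1 : rho1 N φ = rho1 N ψ)
    (h2 : rho2 N φ = rho2 N ψ) :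
    ∃ θ : Fin N → ℝ, ∀ x y,
      φ (x, y) = ∑ i, Complex.exp (Complex.I * (θ i : ℂ)) *
        (Real.sqrt (lam i) : ℂ) * e i x * f i y := by
  open Matrix in
  let U : Matrix (Fin N) (Fin N) ℂ := Matrix.of e
  let V : Matrix (Fin N) (Fin N) ℂ := Matrix.of f
  let Φ : Matrix (Fin N) (Fin N) ℂ := Matrix.of fun x y => φ (x, y)
  let Ψ : Matrix (Fin N) (Fin N) ℂ := Matrix.of fun x y => ψ (x, y)
  let D : Matrix (Fin N) (Fin N) ℂ := diagonal fun i => (Real.sqrt (lam i) : ℂ)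
  have hU : U * Uᴴ = 1 := by
    ext i j
    simpa [U, mul_apply, one_apply] using he_orth i j
  have hV : V * Vᴴ = 1 := by
    ext i j
    simpa [V, mul_apply, one_apply] using hf_orth i j
  have hV' : Vᴴ * V = 1 := mul_eq_one_comm.mp hV
  have hUt : Uᵀᴴ * Uᵀ = 1 := by
    change Uᴴᵀ * Uᵀ = 1
    rw [← transpose_mul, hU, transpose_one]
  have hUt' : Uᵀ * Uᵀᴴ = 1 := mul_eq_one_comm.mp hUt
  have hΨ : Ψ = Uᵀ * D * V := by
    ext x y
    rw [transpose_mul_diagonal_mul_apply]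
    exact hψ x y
  let C := Uᵀᴴ * Φ * Vᴴ
  have hΦ : Φ = Uᵀ * C * V := by
    calc Φ = (Uᵀ * Uᵀᴴ) * Φ * (Vᴴ * V) := by rw [hUt', hV', Matrix.one_mul, Matrix.mul_one]
      _ = Uᵀ * C * V := by simp only [C, Matrix.mul_assoc]
  have g1 : Φ * Φᴴ = Ψ * Ψᴴ := by
    ext x x'
    simpa [rho1, Φ, Ψ, mul_apply] using congrFun (congrFun h1 x) x'
  have g2 : Φᴴ * Φ = Ψᴴ * Ψ := by
    ext y y'
    simpa [rho2, Φ, Ψ, mul_apply, mul_comm] using congrFun (congrFun h2 y') y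
  have hDH : Dᴴ = D := by
    rw [diagonal_conjTranspose]
    congr 1
    ext i
    simp
  have hDD : D * D = diagonal fun i => (lam i : ℂ) := by
    rw [diagonal_mul_diagonal]
    congr 1
    ext i
    rw [← Complex.ofReal_mul, Real.mul_self_sqrt (hpos i).le]
  have c1 : C * Cᴴ = diagonal fun i => (lam i : ℂ) := by
    rw [gram_eq_of_unitary_conj (B := D) hUt hV (by rw [← hΦ, ← hΨ, g1]), hDH, hDD]
  have c2 : Cᴴ * C = diagonal fun i => (lam i : ℂ) := by
    have hadj : ∀ X : Matrix (Fin N) (Fin N) ℂ, (Uᵀ * X * V)ᴴ = Vᴴ * Xᴴ * Uᵀᴴ := fun X => by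
      simp only [conjTranspose_mul, Matrix.mul_assoc]
    have h := gram_eq_of_unitary_conj (P := Vᴴ) (Q := Uᵀᴴ) (A := Cᴴ) (B := Dᴴ)
      (by rwa [conjTranspose_conjTranspose]) (by rwa [conjTranspose_conjTranspose])
      (by rw [← hadj, ← hadj, ← hΦ, ← hΨ, conjTranspose_conjTranspose,
        conjTranspose_conjTranspose, g2])
    rwa [conjTranspose_conjTranspose, conjTranspose_conjTranspose, hDH, hDD] at h
  have hinj : Function.Injective fun i => (lam i : ℂ) := fun i j h => by
    by_contra hij
    exact hdist i j hij (Complex.ofReal_injective h)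
  have hC : C = diagonal fun i => C i i := by
    ext i j
    by_cases hij : i = j
    · rw [hij, diagonal_apply_eq]
    · rw [diagonal_apply_ne _ hij, apply_eq_zero_of_gram_eq_diagonal hinj c1 c2 hij]
  have hCi : ∀ i, C i i * starRingEnd ℂ (C i i) = lam i := fun i => by
    have h := congrFun (congrFun c1 i) i
    rw [hC, diagonal_conjTranspose, diagonal_mul_diagonal, diagonal_apply_eq,
      diagonal_apply_eq] at h
    exact h
  refine ⟨fun i => (C i i).arg, fun x y => ?_⟩
  have h : Φ x y = ∑ i, C i i * U i x * V i y := by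
    rw [← transpose_mul_diagonal_mul_apply, ← hC, ← hΦ]
  refine h.trans (Finset.sum_congr rfl fun i _ => ?_)
  rw [← Complex.eq_exp_arg_mul_sqrt (hCi i)]
  rfl

end
end

section
/- For fixed a, b ∈ ℝ and s ∈ ℂ with a² + b² + |s|² = 1, the family of four-qubit states ψ_t = a·|0000⟩ + b·|W₄⟩ + s·exp(I·t)·|1111⟩ shares the same two-body marginals for all values of t ∈ ℝ. That is, defining ψ_t : Fin 2 × Fin 2 × Fin 2 × Fin 2 → ℂ by ψ_t(x) = a·[x = (0,0,0,0)] + b·W₄(x) + s·exp(I·t)·[x = (1,1,1,1)], all six two-body marginals ρ_AB, ρ_AC, ρ_AD, ρ_BC, ρ_BD, ρ_CD of ψ_t are equal to the corresponding marginals of ψ_0, for every t ∈ ℝ. -/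
/-!
STATEMENT 10: For fixed a, b ∈ ℝ and s ∈ ℂ with a² + b² + |s|² = 1, the family
of four-qubit states ψ_t = a·|0000⟩ + b·|W₄⟩ + s·exp(I·t)·|1111⟩ shares the
same two-body marginals for all values of t ∈ ℝ.
-/

noncomputable section

/-- The two-body marginal on parties A,B of a four-qubit pure state. -/
def rhoAB (ψ : Fin 2 × Fin 2 × Fin 2 × Fin 2 → ℂ) :
    Matrix (Fin 2 × Fin 2) (Fin 2 × Fin 2) ℂ := fun p q =>
  ∑ c : Fin 2, ∑ d : Fin 2,
    ψ (p.1, p.2, c, d) * starRingEnd ℂ (ψ (q.1, q.2, c, d))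

/-- The two-body marginal on parties A,C of a four-qubit pure state. -/
def rhoAC (ψ : Fin 2 × Fin 2 × Fin 2 × Fin 2 → ℂ) :
    Matrix (Fin 2 × Fin 2) (Fin 2 × Fin 2) ℂ := fun p q =>
  ∑ b : Fin 2, ∑ d : Fin 2,
    ψ (p.1, b, p.2, d) * starRingEnd ℂ (ψ (q.1, b, q.2, d))

/-- The two-body marginal on parties A,D of a four-qubit pure state. -/
def rhoAD (ψ : Fin 2 × Fin 2 × Fin 2 × Fin 2 → ℂ) :
    Matrix (Fin 2 × Fin 2) (Fin 2 × Fin 2) ℂ := fun p q =>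
  ∑ b : Fin 2, ∑ c : Fin 2,
    ψ (p.1, b, c, p.2) * starRingEnd ℂ (ψ (q.1, b, c, q.2))

/-- The two-body marginal on parties B,C of a four-qubit pure state. -/
def rhoBC (ψ : Fin 2 × Fin 2 × Fin 2 × Fin 2 → ℂ) :
    Matrix (Fin 2 × Fin 2) (Fin 2 × Fin 2) ℂ := fun p q =>
  ∑ a : Fin 2, ∑ d : Fin 2,
    ψ (a, p.1, p.2, d) * starRingEnd ℂ (ψ (a, q.1, q.2, d))

/-- The two-body marginal on parties B,D of a four-qubit pure state. -/
def rhoBD (ψ : Fin 2 × Fin 2 × Fin 2 × Fin 2 → ℂ) :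
    Matrix (Fin 2 × Fin 2) (Fin 2 × Fin 2) ℂ := fun p q =>
  ∑ a : Fin 2, ∑ c : Fin 2,
    ψ (a, p.1, c, p.2) * starRingEnd ℂ (ψ (a, q.1, c, q.2))

/-- The two-body marginal on parties C,D of a four-qubit pure state. -/
def rhoCD (ψ : Fin 2 × Fin 2 × Fin 2 × Fin 2 → ℂ) :
    Matrix (Fin 2 × Fin 2) (Fin 2 × Fin 2) ℂ := fun p q =>
  ∑ a : Fin 2, ∑ b : Fin 2,
    ψ (a, b, p.1, p.2) * starRingEnd ℂ (ψ (a, b, q.1, q.2))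

/-- Two four-qubit states share all six of their two-body marginals. -/
def SameTwoBodyMarginals (ψ φ : Fin 2 × Fin 2 × Fin 2 × Fin 2 → ℂ) : Prop :=
  rhoAB ψ = rhoAB φ ∧ rhoAC ψ = rhoAC φ ∧ rhoAD ψ = rhoAD φ ∧
  rhoBC ψ = rhoBC φ ∧ rhoBD ψ = rhoBD φ ∧ rhoCD ψ = rhoCD φ

/-- The indicator function of `(0,0,0,0)`, i.e. the state |0000⟩. -/
def ket0000 : Fin 2 × Fin 2 × Fin 2 × Fin 2 → ℂ := fun x =>
  if x = (0, 0, 0, 0) then 1 else 0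

/-- The indicator function of `(1,1,1,1)`, i.e. the state |1111⟩. -/
def ket1111 : Fin 2 × Fin 2 × Fin 2 × Fin 2 → ℂ := fun x =>
  if x = (1, 1, 1, 1) then 1 else 0

/-- The four-qubit W state: value 1/2 on the four tuples with exactly one entry
equal to 1, and 0 elsewhere. -/
def W4 : Fin 2 × Fin 2 × Fin 2 × Fin 2 → ℂ := fun x =>
  if (x.1 : ℕ) + (x.2.1 : ℕ) + (x.2.2.1 : ℕ) + (x.2.2.2 : ℕ) = 1 then 1 / 2 else 0

/-- The four-qubit Dicke state with two excitations: value 1/√6 on the six tuples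
with exactly two entries equal to 1, and 0 elsewhere. -/
def D24 : Fin 2 × Fin 2 × Fin 2 × Fin 2 → ℂ := fun x =>
  if (x.1 : ℕ) + (x.2.1 : ℕ) + (x.2.2.1 : ℕ) + (x.2.2.2 : ℕ) = 2
  then 1 / (Real.sqrt 6 : ℂ) else 0

/-- The sum of the four bits of a computational basis label. -/
def excitations (x : Fin 2 × Fin 2 × Fin 2 × Fin 2) : ℕ :=
  (x.1 : ℕ) + (x.2.1 : ℕ) + (x.2.2.1 : ℕ) + (x.2.2.2 : ℕ)

/-- If changing the amplitude of |1111⟩ by a phase is the only difference between two states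
without components of two or three excitations, then all products of amplitudes at labels which
agree in two positions coincide, and hence so do the two-body marginals. -/
lemma sameTwoBodyMarginals_of_phase {ψ φ : Fin 2 × Fin 2 × Fin 2 × Fin 2 → ℂ}
    (heq : ∀ x, x ≠ (1, 1, 1, 1) → ψ x = φ x)
    (hzero : ∀ x, x ≠ (1, 1, 1, 1) → 2 ≤ excitations x → φ x = 0)
    (hone : ψ (1, 1, 1, 1) * starRingEnd ℂ (ψ (1, 1, 1, 1)) =
      φ (1, 1, 1, 1) * starRingEnd ℂ (φ (1, 1, 1, 1))) :
    SameTwoBodyMarginals ψ φ := by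
  have key : ∀ x y, (x = (1, 1, 1, 1) → 2 ≤ excitations y) →
      (y = (1, 1, 1, 1) → 2 ≤ excitations x) →
      ψ x * starRingEnd ℂ (ψ y) = φ x * starRingEnd ℂ (φ y) := by
    intro x y hx hy
    by_cases h1 : x = (1, 1, 1, 1) <;> by_cases h2 : y = (1, 1, 1, 1)
    · rw [h1, h2, hone]
    · simp [heq y h2, hzero y h2 (hx h1)]
    · simp [heq x h1, hzero x h1 (hy h2)]
    · rw [heq x h1, heq y h2]
  refine ⟨?_, ?_, ?_, ?_, ?_, ?_⟩ <;>
  · ext p q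
    refine Finset.sum_congr rfl fun i _ => Finset.sum_congr rfl fun j _ => key _ _ ?_ ?_ <;>
    · simp only [Prod.mk.injEq, excitations]
      rintro ⟨h1, h2, h3, h4⟩
      simp only [h1, h2, h3, h4, Fin.val_one]
      omega

theorem W_GHZ_family_shares_two_body_marginals
    (a b : ℝ) (s : ℂ)
    (hnorm : a ^ 2 + b ^ 2 + ‖s‖ ^ 2 = 1)
    (ψ : ℝ → Fin 2 × Fin 2 × Fin 2 × Fin 2 → ℂ)
    (hψ : ∀ t x, ψ t x = (a : ℂ) * ket0000 x + (b : ℂ) * W4 x +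
      s * Complex.exp (Complex.I * (t : ℂ)) * ket1111 x) :
    ∀ t : ℝ, SameTwoBodyMarginals (ψ t) (ψ 0) := by
  intro t
  refine sameTwoBodyMarginals_of_phase (fun x hx => ?_) (fun x hx h2 => ?_) ?_
  · simp [hψ, ket1111, hx]
  · have h0 : x ≠ (0, 0, 0, 0) := by
      rintro rfl
      simp [excitations] at h2
    have hW : W4 x = 0 := if_neg (by unfold excitations at h2; omega)
    simp [hψ, ket0000, ket1111, hx, h0, hW]
  · have hexp : ‖Complex.exp (Complex.I * t)‖ = 1 := by
      rw [mul_comm, Complex.norm_exp_ofReal_mul_I]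
    simp only [Complex.mul_conj']
    simp [hψ, ket0000, ket1111, W4, hexp]

end
end

section
/- The family of four-qubit states φ_t = (1/2)·|0000⟩ + (1/√2)·exp(I·t)·|D₂⁴⟩ − (1/2)·exp(2I·t)·|1111⟩ shares the same two-body marginals for all values of t ∈ ℝ. That is, defining φ_t : Fin 2 × Fin 2 × Fin 2 × Fin 2 → ℂ by φ_t(x) = (1/2)·[x = (0,0,0,0)] + (1/√2)·exp(I·t)·D₂⁴(x) − (1/2)·exp(2I·t)·[x = (1,1,1,1)], all six two-body marginals ρ_AB, ρ_AC, ρ_AD, ρ_BC, ρ_BD, ρ_CD of φ_t are equal to the corresponding marginals of φ_0, for every t ∈ ℝ. -/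
/-!
STATEMENT 12: The family of four-qubit states
φ_t = (1/2)·|0000⟩ + (1/√2)·exp(I·t)·|D₂⁴⟩ − (1/2)·exp(2I·t)·|1111⟩
shares the same two-body marginals for all values of t ∈ ℝ.
-/

noncomputable section

/-- For states whose amplitudes depend only on the number of excitations, all two-body marginals
agree as soon as the reduced sums indexed by the excitation numbers of the kept pair agree. -/
theorem sameTwoBodyMarginals_of_weight {ψ φ : Fin 2 × Fin 2 × Fin 2 × Fin 2 → ℂ} {f g : ℕ → ℂ}
    (hψ : ∀ a b c d : Fin 2, ψ (a, b, c, d) = f (a + b + (c + d)))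
    (hφ : ∀ a b c d : Fin 2, φ (a, b, c, d) = g (a + b + (c + d)))
    (h : ∀ i ≤ 2, ∀ j ≤ 2,
      ∑ c : Fin 2, ∑ d : Fin 2, f (i + (c + d)) * starRingEnd ℂ (f (j + (c + d))) =
      ∑ c : Fin 2, ∑ d : Fin 2, g (i + (c + d)) * starRingEnd ℂ (g (j + (c + d)))) :
    SameTwoBodyMarginals ψ φ := by
  refine ⟨?_, ?_, ?_, ?_, ?_, ?_⟩ <;> ext p q <;>
    simpa only [rhoAB, rhoAC, rhoAD, rhoBC, rhoBD, rhoCD, hψ, hφ, add_comm, add_left_comm] using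
      h (p.1 + p.2) (by omega) (q.1 + q.2) (by omega)

/-- The amplitude of a basis state with `n` excitations in the Dicke–GHZ family with phase `e`. -/
def dickeGHZAmplitude (e : ℂ) (n : ℕ) : ℂ :=
  if n = 0 then 1 / 2
  else if n = 2 then 1 / (Real.sqrt 2 : ℂ) * e * (1 / (Real.sqrt 6 : ℂ))
  else if n = 4 then -(1 / 2 * e ^ 2)
  else 0

/-- The reduced sums of the Dicke–GHZ amplitudes do not depend on the phase. -/
theorem sum_dickeGHZAmplitude {e : ℂ} (he : e * starRingEnd ℂ e = 1)
    {i j : ℕ} (hi : i ≤ 2) (hj : j ≤ 2) :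
    ∑ c : Fin 2, ∑ d : Fin 2, dickeGHZAmplitude e (i + (c + d)) *
        starRingEnd ℂ (dickeGHZAmplitude e (j + (c + d))) =
      ∑ c : Fin 2, ∑ d : Fin 2, dickeGHZAmplitude 1 (i + (c + d)) *
        starRingEnd ℂ (dickeGHZAmplitude 1 (j + (c + d))) := by
  interval_cases i <;> interval_cases j <;>
    simp [dickeGHZAmplitude, Fin.sum_univ_two, Complex.conj_ofNat] <;> grind

theorem Dicke_GHZ_family_shares_two_body_marginals
    (φ : ℝ → Fin 2 × Fin 2 × Fin 2 × Fin 2 → ℂ)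
    (hφ : ∀ t x, φ t x = (1 / 2 : ℂ) * ket0000 x +
      (1 / (Real.sqrt 2 : ℂ)) * Complex.exp (Complex.I * (t : ℂ)) * D24 x -
      (1 / 2 : ℂ) * Complex.exp (2 * Complex.I * (t : ℂ)) * ket1111 x) :
    ∀ t : ℝ, SameTwoBodyMarginals (φ t) (φ 0) := by
  intro t
  have key (s : ℝ) (a b c d : Fin 2) : φ s (a, b, c, d) =
      dickeGHZAmplitude (Complex.exp (Complex.I * s)) (a + b + (c + d)) := by
    have hsq : Complex.exp (2 * Complex.I * s) = Complex.exp (Complex.I * s) ^ 2 := by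
      rw [← Complex.exp_nat_mul]
      congr 1
      push_cast
      ring
    rw [hφ, hsq]
    fin_cases a <;> fin_cases b <;> fin_cases c <;> fin_cases d <;>
      simp [dickeGHZAmplitude, ket0000, ket1111, D24]
  refine sameTwoBodyMarginals_of_weight (key t) (key 0) fun i hi j hj ↦ ?_
  rw [Complex.ofReal_zero, mul_zero, Complex.exp_zero]
  refine sum_dickeGHZAmplitude ?_ hi hj
  rw [← Complex.exp_conj, ← Complex.exp_add]
  simp

end
end
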